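/- If Θ is not the identity automorphism of F, then the quotient of A(m,Θ) by its center is isomorphic to the additive group of F; in particular A(m,Θ)/Z(A(m,Θ)) is elementary abelian of order 2^m. -/

import Mathlib

/-- The underlying set of the Suzuki 2-group `A(m,Θ)`: pairs `(a, b)` of elements of `F`,
with multiplication `(a,c)·(b,d) = (a+b, c+d+b·Θ(a))`. -/
@[ext]
structure Suzuki (F : Type*) [Field F] (Θ : F ≃+* F) where
  a : F
  b : F

namespace Suzuki

variable {F : Type*} [Field F] {Θ : F ≃+* F}

instance : Mul (Suzuki F Θ) := ⟨fun x y => ⟨x.a + y.a, x.b + y.b + y.a * Θ x.a⟩⟩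
instance : One (Suzuki F Θ) := ⟨⟨0, 0⟩⟩
instance : Inv (Suzuki F Θ) := ⟨fun x => ⟨-x.a, -x.b + x.a * Θ x.a⟩⟩

@[simp] lemma mul_a (x y : Suzuki F Θ) : (x * y).a = x.a + y.a := rfl
@[simp] lemma mul_b (x y : Suzuki F Θ) : (x * y).b = x.b + y.b + y.a * Θ x.a := rfl
@[simp] lemma one_a : (1 : Suzuki F Θ).a = 0 := rfl
@[simp] lemma one_b : (1 : Suzuki F Θ).b = 0 := rfl
@[simp] lemma inv_a (x : Suzuki F Θ) : (x⁻¹).a = -x.a := rfl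
@[simp] lemma inv_b (x : Suzuki F Θ) : (x⁻¹).b = -x.b + x.a * Θ x.a := rfl

/-- The Suzuki 2-group `A(m,Θ)`. -/
instance : Group (Suzuki F Θ) where
  mul_assoc x y z := by ext <;> simp [map_add] <;> ring
  one_mul x := by ext <;> simp
  mul_one x := by ext <;> simp
  inv_mul_cancel x := by ext <;> simp [map_neg]

variable (F Θ) in
/-- The projection of `A(m,Θ)` onto its first coordinate. -/
def fstHom : Suzuki F Θ →* Multiplicative F where
  toFun x := Multiplicative.ofAdd x.a
  map_one' := rfl
  map_mul' _ _ := rfl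

lemma mem_ker_fstHom {x : Suzuki F Θ} : x ∈ (fstHom F Θ).ker ↔ x.a = 0 := Iff.rfl

lemma fstHom_surjective : Function.Surjective (fstHom F Θ) :=
  fun y => ⟨⟨y.toAdd, 0⟩, rfl⟩

lemma mul_comm_iff (x y : Suzuki F Θ) : y * x = x * y ↔ x.a * Θ y.a = y.a * Θ x.a := by
  rw [Suzuki.ext_iff, mul_a, mul_a, mul_b, mul_b, add_comm y.a, add_comm y.b]
  simp

/-- If `Θ` is not the identity, the center of `A(m,Θ)` consists of the pairs `(0, b)`. -/
lemma mem_center_iff (hΘ : Θ ≠ RingEquiv.refl F) {x : Suzuki F Θ} :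
    x ∈ Subgroup.center (Suzuki F Θ) ↔ x.a = 0 := by
  simp only [Subgroup.mem_center_iff, mul_comm_iff]
  refine ⟨fun h => ?_, fun h y => by simp [h]⟩
  by_contra hx
  refine hΘ (RingEquiv.ext fun c => ?_)
  have hfix : Θ x.a = x.a := by simpa using (h ⟨1, 0⟩).symm
  have hc : x.a * Θ c = c * Θ x.a := h ⟨c, 0⟩
  rw [hfix, mul_comm c] at hc
  exact mul_left_cancel₀ hx hc

end Suzuki

/-- If `Θ` is not the identity automorphism of `F`, then the quotient of `A(m,Θ)` by its
center is isomorphic to the additive group of `F`; in particular `A(m,Θ)/Z(A(m,Θ))` is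
elementary abelian of order `2^m`. -/
theorem Suzuki.quotient_center (m : ℕ) (hm : 3 ≤ m) (hodd : Odd m)
    (F : Type*) [Field F] (hF : Nat.card F = 2 ^ m) (Θ : F ≃+* F)
    (hΘ : Θ ≠ RingEquiv.refl F) :
    Nonempty ((Suzuki F Θ ⧸ Subgroup.center (Suzuki F Θ)) ≃* Multiplicative F) ∧
    Nat.card (Suzuki F Θ ⧸ Subgroup.center (Suzuki F Θ)) = 2 ^ m ∧
    ∀ g : Suzuki F Θ ⧸ Subgroup.center (Suzuki F Θ), g ^ 2 = 1 := by
  have hker : Subgroup.center (Suzuki F Θ) = (fstHom F Θ).ker :=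
    Subgroup.ext fun x => (mem_center_iff hΘ).trans mem_ker_fstHom.symm
  let e : (Suzuki F Θ ⧸ Subgroup.center (Suzuki F Θ)) ≃* Multiplicative F :=
    (QuotientGroup.quotientMulEquivOfEq hker).trans
      (QuotientGroup.quotientKerEquivOfSurjective _ fstHom_surjective)
  have htwo : (2 : F) = 0 := by
    have : Finite F := Nat.finite_of_card_ne_zero (by simp [hF])
    have : Fintype F := Fintype.ofFinite F
    have h : ((2 ^ m : ℕ) : F) = 0 := by
      rw [← hF, Nat.card_eq_fintype_card, FiniteField.cast_card_eq_zero]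
    exact eq_zero_of_pow_eq_zero (by exact_mod_cast h)
  refine ⟨⟨e⟩, (Nat.card_congr (e.toEquiv.trans Multiplicative.toAdd)).trans hF, fun g => ?_⟩
  apply e.injective
  rw [map_pow, map_one]
  apply Multiplicative.toAdd.injective
  rw [toAdd_pow, toAdd_one, two_nsmul, ← two_mul, htwo, zero_mul]
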